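/- (Prefix order.) For all messages m m' : M and all groups g h : G with g ∈ D m ∩ D m' and h ∈ D m ∩ D m', one has: ord g m m' holds iff ord h m m' holds. In particular, it cannot happen that one common destination group delivers m before m' while another common destination group delivers m' before m. -/

import Mathlib

/-- The ancestor relation: `a` is an ancestor of `b` iff some iterate of the
parent function maps `b` to `a`. -/
def anc {G : Type*} (p : G → G) (a b : G) : Prop := ∃ k : ℕ, p^[k] b = a

/-- The ordering path of a message `m`: the groups lying on a downward path
from the least common ancestor `L m` to some destination of `m`. -/
def orderPath {G M : Type*} (p : G → G) (D : M → Set G) (L : M → G) (m : M) : Set G :=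
  {g : G | anc p (L m) g ∧ ∃ x ∈ D m, anc p g x}

theorem anc_trans {G : Type*} {p : G → G} {a b c : G}
    (hab : anc p a b) (hbc : anc p b c) : anc p a c := by
  obtain ⟨k, rfl⟩ := hab
  obtain ⟨l, rfl⟩ := hbc
  exact ⟨k + l, Function.iterate_add_apply p k l c⟩

theorem anc_total_of_anc {G : Type*} {p : G → G} {a b c : G}
    (hac : anc p a c) (hbc : anc p b c) : anc p a b ∨ anc p b a := by
  obtain ⟨k, rfl⟩ := hac
  obtain ⟨l, rfl⟩ := hbc
  rcases le_total k l with h | h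
  · exact .inr ⟨l - k, by rw [← Function.iterate_add_apply, Nat.sub_add_cancel h]⟩
  · exact .inl ⟨k - l, by rw [← Function.iterate_add_apply, Nat.sub_add_cancel h]⟩

theorem orderPath_of_anc {G M : Type*} {p : G → G} {D : M → Set G} {L : M → G} {m : M}
    {a b : G} (ha : anc p (L m) a) (hab : anc p a b) (hb : b ∈ orderPath p D L m) :
    a ∈ orderPath p D L m := by
  obtain ⟨-, x, hx, hbx⟩ := hb
  exact ⟨ha, x, hx, anc_trans hab hbx⟩

/-- Local consistency propagates along a downward path inside both ordering paths. -/
theorem ord_iff_of_anc {G M : Type*} {p : G → G} {D : M → Set G} {L : M → G}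
    {ord : G → M → M → Prop}
    (hloc : ∀ g h : G, p h = g → ∀ m m' : M,
      g ∈ orderPath p D L m ∩ orderPath p D L m' →
      h ∈ orderPath p D L m ∩ orderPath p D L m' →
      (ord g m m' ↔ ord h m m'))
    {m m' : M} {a b : G} (ha : anc p (L m) a) (ha' : anc p (L m') a) (hab : anc p a b)
    (hb : b ∈ orderPath p D L m ∩ orderPath p D L m') :
    ord a m m' ↔ ord b m m' := by
  obtain ⟨k, hk⟩ := hab
  induction k generalizing b with
  | zero => rw [← hk, Function.iterate_zero_apply]
  | succ k ih =>
    rw [Function.iterate_succ_apply] at hk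
    have hpb : p b ∈ orderPath p D L m ∩ orderPath p D L m' :=
      ⟨orderPath_of_anc (anc_trans ha ⟨k, hk⟩) ⟨1, rfl⟩ hb.1,
        orderPath_of_anc (anc_trans ha' ⟨k, hk⟩) ⟨1, rfl⟩ hb.2⟩
    exact (ih hpb hk).trans (hloc (p b) b rfl m m' hpb hb)

/-- Prefix order: any two common destination groups of two messages order
them identically. -/
theorem prefix_order {G M : Type*} (p : G → G)
    (D : M → Set G) (L : M → G)
    (hL : ∀ m : M, ∀ g ∈ D m, anc p (L m) g)
    (ord : G → M → M → Prop)
    (hirr : ∀ g : G, ∀ m : M, ¬ ord g m m)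
    (htrans : ∀ g : G, ∀ m₁ m₂ m₃ : M, ord g m₁ m₂ → ord g m₂ m₃ → ord g m₁ m₃)
    (hloc : ∀ g h : G, p h = g → ∀ m m' : M,
      g ∈ orderPath p D L m ∩ orderPath p D L m' →
      h ∈ orderPath p D L m ∩ orderPath p D L m' →
      (ord g m m' ↔ ord h m m'))
    (m m' : M) (g h : G)
    (hg : g ∈ D m ∩ D m')
    (hh : h ∈ D m ∩ D m') :
    (ord g m m' ↔ ord h m m') := by
  have hdest : ∀ x ∈ D m ∩ D m', x ∈ orderPath p D L m ∩ orderPath p D L m' :=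
    fun x hx => ⟨⟨hL m x hx.1, x, hx.1, 0, rfl⟩, ⟨hL m' x hx.2, x, hx.2, 0, rfl⟩⟩
  obtain ⟨a, ha, ha', hag, hah⟩ :
      ∃ a, anc p (L m) a ∧ anc p (L m') a ∧ anc p a g ∧ anc p a h := by
    rcases anc_total_of_anc (hL m g hg.1) (hL m' g hg.2) with hanc | hanc
    · exact ⟨L m', hanc, ⟨0, rfl⟩, hL m' g hg.2, hL m' h hh.2⟩
    · exact ⟨L m, ⟨0, rfl⟩, hanc, hL m g hg.1, hL m h hh.1⟩
  exact (ord_iff_of_anc hloc ha ha' hag (hdest g hg)).symm.trans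
    (ord_iff_of_anc hloc ha ha' hah (hdest h hh))
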